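/- arXiv:1312.6839 — 2 statements merged into one kernel-verified Lean document; each statement's English description precedes it below -/
import Mathlib

section
/- Let p \geq 5 be a prime and n \leq p^2 - 1 a positive integer. If x^n is 3-PN over \mathbb{F}_{p^2}, then n \in \{4, 4p\}. -/
def nabla {F : Type} [Field F] (a : F) (f : F → F) : F → F :=
  fun x => f (x + a) - f x

def nablaIter {F : Type} [Field F] (as : List F) (f : F → F) : F → F :=
  as.foldl (fun g a => nabla a g) f

def IsKPN (k : ℕ) {F : Type} [Field F] (f : F → F) : Prop :=
  ∀ as : List F, as.length = k → (∀ a ∈ as, a ≠ 0) →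
    Function.Bijective (nablaIter as f)

/-- power sums vanish -/
theorem aux_sum_poly {K : Type} [Field K] [Fintype K] (Q : Polynomial K)
    (hQ : Q.natDegree ≤ Fintype.card K - 1) :
    ∑ x : K, Q.eval x = - Q.coeff (Fintype.card K - 1) := by
  have hc : 1 < Fintype.card K := Fintype.one_lt_card
  have h1 : ∀ x : K, Q.eval x = ∑ i ∈ Finset.range (Fintype.card K - 1 + 1), Q.coeff i * x ^ i := by
    intro x
    exact Polynomial.eval_eq_sum_range' (by omega) x
  simp_rw [h1]
  rw [Finset.sum_comm, Finset.sum_range_succ]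
  rw [Finset.sum_eq_zero, zero_add, ← Finset.mul_sum]
  · classical
    have := FiniteField.sum_pow_units K (Fintype.card K - 1)
    have h2 : ∑ x : K, x ^ (Fintype.card K - 1) = -1 := by
      have h3 : ∀ x : K, x ^ (Fintype.card K - 1) = 1 - if x = 0 then 1 else 0 := by
        intro x
        split_ifs with hx
        · subst hx; rw [zero_pow (by omega)]; ring
        · rw [FiniteField.pow_card_sub_one_eq_one x hx]; ring
      simp_rw [h3]
      simp [Finset.sum_sub_distrib]
    rw [h2]; ring
  · intro i hi
    rw [← Finset.mul_sum, FiniteField.sum_pow_lt_card_sub_one K i (by simpa using hi), mul_zero]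

theorem aux_bij_sum {K : Type} [Field K] [Fintype K] (g : K → K) (hg : Function.Bijective g)
    (i : ℕ) (hi : i < Fintype.card K - 1) : ∑ x, g x ^ i = 0 := by
  rw [← FiniteField.sum_pow_lt_card_sub_one K i hi]
  exact Function.Bijective.sum_comp hg (fun y => y ^ i)

theorem aux_choose_dvd {p n k : ℕ} (hp : p.Prime) (hn : n < p) (hk : k ≤ n) :
    ¬ p ∣ n.choose k := by
  intro hd
  have h1 : p ∣ n.factorial := by
    rw [← Nat.choose_mul_factorial_mul_factorial hk, mul_assoc]
    exact Dvd.dvd.mul_right hd _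
  rw [hp.dvd_factorial] at h1
  omega

theorem aux_choose {p n k : ℕ} [Fact p.Prime] (hn : n < p) (hk : k ≤ n) :
    ((n.choose k : ℕ) : ZMod p) ≠ 0 := by
  rw [Ne, ZMod.natCast_eq_zero_iff]
  exact aux_choose_dvd Fact.out hn hk

/-- planar lemma -/
theorem aux_planar {p : ℕ} [Fact p.Prime] (F : ZMod p → ZMod p)
    (hF : ∀ a : ZMod p, a ≠ 0 → Function.Bijective (fun x => F (x + a) - F x)) (r : ℕ)
    (hr : 2 * r < p - 1) : ∑ x, F x ^ r = 0 := by
  induction r using Nat.strong_induction_on with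
  | _ r ih =>
  rcases Nat.eq_zero_or_pos r with h0 | hpos
  · subst h0; simp
  have hA : ∑ a : ZMod p, ∑ x : ZMod p, (F (x + a) - F x) ^ (2 * r) = 0 := by
    apply Finset.sum_eq_zero
    intro a _
    by_cases ha : a = 0
    · subst ha; simp [hpos.ne']
    · exact aux_bij_sum _ (hF a ha) _ (by rw [ZMod.card]; exact hr)
  have hB : ∑ a : ZMod p, ∑ x : ZMod p, (F (x + a) - F x) ^ (2 * r)
      = ∑ i ∈ Finset.range (2 * r + 1),
        (∑ y, F y ^ i) * (∑ x, F x ^ (2 * r - i)) * ((-1) ^ (2 * r - i) * ((2 * r).choose i : ZMod p)) := by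
    rw [Finset.sum_comm]
    have : ∀ x : ZMod p, ∑ a : ZMod p, (F (x + a) - F x) ^ (2 * r)
        = ∑ y : ZMod p, (F y - F x) ^ (2 * r) := fun x =>
      Equiv.sum_comp (Equiv.addLeft x) (fun y => (F y - F x) ^ (2 * r))
    simp_rw [this, sub_eq_add_neg, add_pow]
    simp_rw [Finset.sum_mul_sum, Finset.sum_mul]
    rw [Finset.sum_comm]
    simp_rw [Finset.sum_comm (t := Finset.range (2 * r + 1))]
    refine Finset.sum_congr rfl fun i _ => Finset.sum_congr rfl fun y _ =>
      Finset.sum_congr rfl fun x _ => ?_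
    rw [neg_pow (F x)]; ring
  rw [hB, Finset.sum_eq_single r] at hA
  · have h2 : 2 * r - r = r := by omega
    rw [h2] at hA
    have hch := aux_choose (p := p) (n := 2 * r) (k := r) (by omega) (by omega)
    have h1 : ((-1 : ZMod p)) ^ r ≠ 0 := pow_ne_zero _ (by simp)
    simpa [hch, h1] using hA
  · intro i hi hne
    rcases lt_or_gt_of_ne hne with hlt | hgt
    · rw [ih i hlt (by omega)]; ring
    · have : i ≤ 2 * r := by simpa [Nat.lt_succ_iff] using hi
      rw [ih (2 * r - i) (by omega) (by omega)]; ring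
  · intro h; exact absurd (Finset.mem_range.2 (by omega)) h

theorem aux_planar2 {p : ℕ} [Fact p.Prime] (h : ZMod p → ZMod p)
    (hF : ∀ a : ZMod p, a ≠ 0 → Function.Bijective (fun x => h (x + a) - h x)) (i l : ℕ)
    (hr : 2 * (i + l) < p - 1) : ∑ x, h x ^ i * x ^ l = 0 := by
  have h1 : ∀ t : ZMod p, ∑ x, (h x + t * x) ^ (i + l) = 0 := by
    intro t
    refine aux_planar (fun x => h x + t * x) ?_ _ hr
    intro a ha
    have : (fun x => (h (x + a) + t * (x + a)) - (h x + t * x))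
        = (fun y => y + t * a) ∘ (fun x => h (x + a) - h x) := by
      funext x; simp only [Function.comp]; ring
    rw [this]
    exact (Equiv.addRight (t * a)).bijective.comp (hF a ha)
  let P : Polynomial (ZMod p) := ∑ j ∈ Finset.range (i + l + 1),
    Polynomial.C ((∑ x, h x ^ (i + l - j) * x ^ j) * ((i + l).choose j : ZMod p)) * Polynomial.X ^ j
  have hP : P = 0 := by
    apply Polynomial.eq_zero_of_natDegree_lt_card_of_eval_eq_zero P (f := (id : ZMod p → ZMod p))
      Function.injective_id
    · intro t
      rw [← h1 t]
      simp only [P, Polynomial.eval_finsetSum, Polynomial.eval_mul, Polynomial.eval_C,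
        Polynomial.eval_pow, Polynomial.eval_X, id, Finset.sum_mul]
      rw [Finset.sum_comm]
      refine Finset.sum_congr rfl fun x _ => ?_
      rw [add_comm (h x), add_pow]
      refine Finset.sum_congr rfl fun j _ => ?_
      ring
    · rw [ZMod.card]
      have : P.natDegree ≤ i + l := by
        apply Polynomial.natDegree_sum_le_of_forall_le
        intro j hj
        refine (Polynomial.natDegree_C_mul_X_pow_le _ _).trans ?_
        have := Finset.mem_range.1 hj
        omega
      omega
  have hc : P.coeff l = 0 := by rw [hP]; simp
  simp only [P, Polynomial.finsetSum_coeff, Polynomial.coeff_C_mul_X_pow] at hc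
  rw [Finset.sum_ite_eq] at hc
  have hne := aux_choose (p := p) (n := i + l) (k := l) (by omega) (by omega)
  simpa [hne, show l < i + l + 1 by omega] using hc

theorem aux_diff {K : Type} [Field K] (Q : Polynomial K) (k : ℕ) (hQ : Q.natDegree ≤ k + 1) :
    (Polynomial.taylor 1 Q - Q).natDegree ≤ k ∧
    (Polynomial.taylor 1 Q - Q).coeff k = (k + 1) * Q.coeff (k + 1) := by
  have hev : ∀ j, (Polynomial.hasseDeriv j Q).natDegree ≤ Q.natDegree - j := fun j =>
    Polynomial.natDegree_hasseDeriv_le Q j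
  constructor
  · rw [Polynomial.natDegree_le_iff_coeff_eq_zero]
    intro N hN
    rw [Polynomial.coeff_sub, Polynomial.taylor_coeff,
      Polynomial.eval_eq_sum_range' (n := 1) (by have := hev N; omega)]
    simp [Polynomial.hasseDeriv_coeff]
  · rw [Polynomial.coeff_sub, Polynomial.taylor_coeff,
      Polynomial.eval_eq_sum_range' (n := 2) (by have := hev k; omega)]
    simp [Polynomial.hasseDeriv_coeff, Finset.sum_range_succ, add_comm 1 k]

theorem aux_prime {p n : ℕ} [Fact p.Prime] (hp5 : 5 ≤ p) (hn : 0 < n)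
    (H : ∀ a b c : ZMod p, a ≠ 0 → b ≠ 0 → c ≠ 0 →
      Function.Bijective (nabla c (nabla b (nabla a (fun x : ZMod p => x ^ n))))) :
    ∃ k, n = 4 + k * (p - 1) := by
  have hp : p.Prime := Fact.out
  have hpodd : p % 2 = 1 := by
    rcases hp.eq_two_or_odd with h | h <;> omega
  have h4 : nabla 1 (nabla 1 (nabla 1 (fun x : ZMod p => x ^ n))) (-2 + 1) ≠
      nabla 1 (nabla 1 (nabla 1 (fun x : ZMod p => x ^ n))) (-2) := by
    intro he
    have := (H 1 1 1 one_ne_zero one_ne_zero one_ne_zero).1 he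
    simp at this
  -- the reduced exponent
  obtain ⟨k, m, hm1, hm2, hnm⟩ : ∃ k m, 1 ≤ m ∧ m ≤ p - 1 ∧ n = m + k * (p - 1) := by
    refine ⟨(n - 1) / (p - 1), (n - 1) % (p - 1) + 1, by omega, ?_, ?_⟩
    · have := Nat.mod_lt (n - 1) (show 0 < p - 1 by omega)
      omega
    · have := Nat.mod_add_div' (n - 1) (p - 1)
      omega
  have hf : (fun x : ZMod p => x ^ n) = fun x => x ^ m := by
    funext x
    by_cases hx : x = 0
    · subst hx; rw [zero_pow (by omega), zero_pow (by omega)]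
    · rw [hnm, pow_add, mul_comm k, pow_mul, ZMod.pow_card_sub_one_eq_one hx]; simp
  rw [hf] at H h4
  clear hf
  have hmeven : Even m := by
    by_contra hodd
    rw [Nat.not_even_iff_odd] at hodd
    apply h4
    simp only [nabla]
    ring_nf
    rw [show (-2 : ZMod p) = -(2) by ring, hodd.neg_pow, hodd.neg_pow, zero_pow (by omega)]
    rw [one_pow]; ring
  have hm4 : m ≠ 2 := by
    rintro rfl
    apply h4
    simp only [nabla]; ring
  by_cases hm : m = 4
  · exact ⟨k, by omega⟩
  exfalso
  obtain ⟨w, hw⟩ := hmeven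
  -- second difference
  obtain ⟨e, rfl⟩ : ∃ e, m = e + 3 := ⟨m - 3, by omega⟩
  let Q0 : Polynomial (ZMod p) := Polynomial.X ^ (e + 3)
  let Q1 := Polynomial.taylor 1 Q0 - Q0
  let Q2 := Polynomial.taylor 1 Q1 - Q1
  let Q3 := Polynomial.taylor 1 Q2 - Q2
  have d0 : Q0.natDegree ≤ e + 2 + 1 := by simp [Q0]
  have c0 : Q0.coeff (e + 2 + 1) = 1 := by simp [Q0]
  obtain ⟨d1, c1⟩ := aux_diff Q0 (e + 2) d0
  obtain ⟨d2, c2⟩ := aux_diff Q1 (e + 1) d1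
  obtain ⟨d3, c3⟩ := aux_diff Q2 e d2
  rw [c0] at c1
  rw [c1] at c2
  rw [c2] at c3
  have ev : ∀ (Q : Polynomial (ZMod p)) (x : ZMod p), (Polynomial.taylor 1 Q - Q).eval x
      = nabla 1 (fun y => Q.eval y) x := by
    intro Q x
    simp [nabla, Polynomial.taylor_eval]
  have e0 : (fun x => Q0.eval x) = fun x : ZMod p => x ^ (e + 3) := by funext x; simp [Q0]
  have e1 : (fun x => Q1.eval x) = nabla 1 (fun x : ZMod p => x ^ (e + 3)) := by
    funext x; rw [← e0]; exact ev Q0 x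
  have e2 : (fun x => Q2.eval x) = nabla 1 (nabla 1 (fun x : ZMod p => x ^ (e + 3))) := by
    funext x; rw [← e1]; exact ev Q1 x
  have e3 : (fun x => Q3.eval x) = nabla 1 (nabla 1 (nabla 1 (fun x : ZMod p => x ^ (e + 3)))) := by
    funext x; rw [← e2]; exact ev Q2 x
  have nz : ∀ j : ℕ, 0 < j → j < p → (j : ZMod p) ≠ 0 := by
    intro j h0 h1
    rw [Ne, ZMod.natCast_eq_zero_iff]
    exact Nat.not_dvd_of_pos_of_lt h0 h1
  have n1 := nz (e + 1) (by omega) (by omega)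
  have n2 := nz (e + 2) (by omega) (by omega)
  have n3 := nz (e + 3) (by omega) (by omega)
  push_cast at n1 n2 n3
  have hc2 : Q2.coeff (e + 1) ≠ 0 := by
    rw [c2]; push_cast
    refine mul_ne_zero (by convert n2 using 1; ring) (mul_ne_zero (by convert n3 using 1; ring) one_ne_zero)
  have hc3 : Q3.coeff e ≠ 0 := by
    rw [c3]
    refine mul_ne_zero n1 ?_
    rw [← c2]; exact hc2
  have hplan : ∀ i l, 2 * (i + l) < p - 1 → ∑ x, (Q2.eval x) ^ i * x ^ l = 0 := by
    intro i l hil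
    refine aux_planar2 (fun x => Q2.eval x) ?_ i l hil
    intro a ha
    have hb := H 1 1 a one_ne_zero one_ne_zero ha
    rw [← e2] at hb
    exact hb
  have key : ∀ (Q : Polynomial (ZMod p)) (d i l : ℕ), Q.natDegree ≤ d → Q.coeff d ≠ 0 →
      i * d + l = p - 1 → ∑ x, (Q.eval x) ^ i * x ^ l ≠ 0 := by
    intro Q d i l hd hc hil
    have hh := aux_sum_poly (Q ^ i * Polynomial.X ^ l) (by
      rw [ZMod.card, ← hil]
      refine Polynomial.natDegree_mul_le_of_le (Polynomial.natDegree_pow_le_of_le i hd) ?_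
      exact Polynomial.natDegree_X_pow_le l)
    simp only [Polynomial.eval_mul, Polynomial.eval_pow, Polynomial.eval_X] at hh
    rw [hh, ZMod.card, ← hil, Polynomial.coeff_mul_X_pow, Polynomial.coeff_pow_of_natDegree_le hd]
    exact neg_ne_zero.2 (pow_ne_zero _ hc)
  by_cases hsp : 2 * e = p - 1
  · apply key Q3 e 2 0 d3 hc3 (by omega)
    have hb := H 1 1 1 one_ne_zero one_ne_zero one_ne_zero
    rw [← e3] at hb
    simpa using aux_bij_sum _ hb 2 (by rw [ZMod.card]; omega)
  · have hdm := Nat.div_add_mod (p - 1) (e + 1)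
    have hlt := Nat.mod_lt (p - 1) (show 0 < e + 1 by omega)
    set i := (p - 1) / (e + 1) with hi
    set l := (p - 1) % (e + 1) with hl
    apply key Q2 (e + 1) i l d2 hc2 (by rw [mul_comm]; exact hdm)
    apply hplan
    have hi1 : 1 ≤ i := by
      rw [hi, Nat.one_le_div_iff (by omega)]; omega
    rcases Nat.lt_or_ge i 2 with h2 | h2
    · have : i = 1 := by omega
      rw [this] at hdm ⊢
      omega
    · have he : 3 ≤ e := by omega
      nlinarith

theorem aux_sum_pow {F : Type} [Field F] [Fintype F] (E : ℕ) (hE : 0 < E) :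
    ∑ x : F, x ^ E = if (Fintype.card F - 1) ∣ E then -1 else 0 := by
  classical
  rw [← FiniteField.sum_pow_units F E]
  have h1 : ∑ x : F, x ^ E = ∑ x ∈ Finset.univ.filter (fun x : F => x ≠ 0), x ^ E := by
    rw [Finset.sum_filter]
    refine Finset.sum_congr rfl fun x _ => ?_
    split_ifs with h
    · rfl
    · have : x = 0 := by simpa using h
      rw [this, zero_pow hE.ne']
  rw [h1]
  symm
  refine Finset.sum_bij (fun u _ => (u : F)) ?_ ?_ ?_ ?_
  · intro u _; simp
  · intro u _ v _ h; exact Units.ext h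
  · intro x hx
    have : x ≠ 0 := by simpa using hx
    exact ⟨Units.mk0 x this, Finset.mem_univ _, rfl⟩
  · intro u _; simp

theorem aux_c_ne {p n α β : ℕ} {F : Type} [Field F] [Fintype F] [CharP F p] (hp : p.Prime)
    (hp7 : 7 ≤ p) (hF : Fintype.card F = p ^ 2) (hn : n = α + β * p) (hα : α < p) (hβ : β < p)
    (hs : α + β = p + 3) : ∑ x : F, (x + 1) ^ n * (x ^ n) ^ p ≠ 0 := by
  have : Fact p.Prime := ⟨hp⟩
  have hx2 : ∀ x : F, x ^ (p * p) = x := by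
    intro x
    have := FiniteField.pow_card x
    rwa [hF, pow_two] at this
  have h1 : ∀ x : F, (x + 1) ^ n * (x ^ n) ^ p = ∑ i ∈ Finset.range (α + 1),
      ∑ j ∈ Finset.range (β + 1), ((α.choose i : F) * (β.choose j : F)) *
        x ^ ((i + β) + p * (j + α)) := by
    intro x
    have e1 : (x + 1) ^ n = (x + 1) ^ α * (x ^ p + 1) ^ β := by
      rw [hn, pow_add, mul_comm β p, pow_mul, add_pow_char (p := p), one_pow]
    have e2 : (x ^ n) ^ p = x ^ (p * α) * x ^ β := by
      rw [← pow_mul, hn, add_mul, pow_add, mul_comm α p, mul_assoc, mul_comm β, pow_mul x (p * p), hx2]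
    rw [e1, e2, add_pow x 1, add_pow (x ^ p) 1, Finset.sum_mul_sum, Finset.sum_mul]
    refine Finset.sum_congr rfl fun i _ => ?_
    rw [Finset.sum_mul]
    refine Finset.sum_congr rfl fun j _ => ?_
    simp only [one_pow, mul_one]
    ring
  simp_rw [h1]
  rw [Finset.sum_comm]
  simp_rw [Finset.sum_comm (s := (Finset.univ : Finset F)), ← Finset.mul_sum]
  have hsum : ∀ i j, i ≤ α → j ≤ β → ∑ x : F, x ^ ((i + β) + p * (j + α)) =
      if i = α - 4 ∧ j = β - 4 then -1 else 0 := by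
    intro i j hi hj
    rw [aux_sum_pow _ (by omega), hF]
    congr 1
    apply propext
    have hpp : p ^ 2 = p * p := pow_two p
    have hp7' : 7 * p ≤ p * p := Nat.mul_le_mul_right p hp7
    constructor
    · rintro ⟨t, ht⟩
      obtain ⟨A, hA⟩ : ∃ A, A = i + β := ⟨_, rfl⟩
      obtain ⟨B, hB⟩ : ∃ B, B = j + α := ⟨_, rfl⟩
      rw [← hA, ← hB] at ht
      have hBle : p * B ≤ p * (p + 3) := Nat.mul_le_mul_left p (by omega)
      have ht1 : t = 1 := by
        rcases Nat.lt_or_ge t 2 with h | h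
        · rcases Nat.eq_zero_or_pos t with h0 | h0
          · subst h0; omega
          · omega
        · have := Nat.mul_le_mul_left (p ^ 2 - 1) h
          rw [mul_add] at hBle
          omega
      subst ht1
      have hBB : B = p - 1 := by
        apply le_antisymm
        · by_contra hc
          have : p * p ≤ p * B := Nat.mul_le_mul_left p (by omega)
          omega
        · by_contra hc
          obtain ⟨z, hz⟩ : ∃ z, p = B + 2 + z := ⟨p - B - 2, by omega⟩
          have : p * p = p * B + p * 2 + p * z := by
            conv_lhs => rw [show p * p = p * (B + 2 + z) by rw [← hz]]
            ring
          omega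
      have : p * B + p = p * p := by
        rw [hBB, Nat.mul_sub, Nat.mul_one]; omega
      omega
    · rintro ⟨rfl, rfl⟩
      refine ⟨1, ?_⟩
      have e1 : α - 4 + β = p - 1 := by omega
      have e2 : β - 4 + α = p - 1 := by omega
      rw [e1, e2, Nat.mul_sub]; omega
  rw [Finset.sum_eq_single (α - 4), Finset.sum_eq_single (β - 4)]
  · rw [hsum _ _ (by omega) (by omega)]
    have hh : ∀ a k : ℕ, a < p → k ≤ a → ((a.choose k : ℕ) : F) ≠ 0 := by
      intro a k ha hk
      rw [Ne, CharP.cast_eq_zero_iff F p]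
      exact aux_choose_dvd hp ha hk
    simp [hh α (α - 4) hα (by omega), hh β (β - 4) hβ (by omega)]
  · intro j hj hne
    rw [hsum _ _ (by omega) (by have := Finset.mem_range.1 hj; omega)]
    simp [hne]
  · intro h; exact absurd (Finset.mem_range.2 (by omega)) h
  · intro i hi hne
    apply Finset.sum_eq_zero
    intro j hj
    rw [hsum _ _ (by have := Finset.mem_range.1 hi; omega) (by have := Finset.mem_range.1 hj; omega)]
    simp [hne]
  · intro h; exact absurd (Finset.mem_range.2 (by omega)) h

theorem aux_corr {p n k : ℕ} {F : Type} [Field F] [Fintype F] [CharP F p] (hp : p.Prime)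
    (hp7 : 7 ≤ p) (hF : Fintype.card F = p ^ 2) (hk : n = 4 + k * (p - 1)) (u : F) :
    ∑ x : F, (x + u) ^ n * (x ^ n) ^ p
      = (u ^ (p + 1)) ^ 4 * ∑ x : F, (x + 1) ^ n * (x ^ n) ^ p := by
  have hq : (p + 1) * (p - 1) = p ^ 2 - 1 := by
    have := Nat.sq_sub_sq p 1
    simpa using this.symm
  have hred : ∀ x : F, x ^ (n * (p + 1)) = x ^ (4 * (p + 1)) := by
    intro x
    by_cases hx : x = 0
    · subst hx; rw [zero_pow (Nat.mul_ne_zero (by omega) (by omega)), zero_pow (by omega)]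
    · rw [hk, add_mul, pow_add, mul_assoc, mul_comm (p - 1), hq, mul_comm k, pow_mul x (p ^ 2 - 1),
        ← hF, FiniteField.pow_card_sub_one_eq_one x hx]; simp
  by_cases hu : u = 0
  · subst hu
    rw [zero_pow (by omega), zero_pow (by omega), zero_mul]
    have : ∀ x : F, (x + 0) ^ n * (x ^ n) ^ p = x ^ (4 * (p + 1)) := by
      intro x; rw [← hred x, add_zero]; ring
    simp_rw [this]
    apply FiniteField.sum_pow_lt_card_sub_one
    rw [hF, ← hq, mul_comm]
    exact Nat.mul_lt_mul_of_pos_left (by omega) (by omega)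
  · rw [Finset.mul_sum, ← Equiv.sum_comp (Equiv.mulLeft₀ u hu)]
    refine Finset.sum_congr rfl fun x _ => ?_
    have e1 := hred u
    change (u * x + u) ^ n * ((u * x) ^ n) ^ p = _
    rw [show u * x + u = u * (x + 1) by ring, mul_pow, mul_pow, mul_pow,
      show (u ^ (p + 1)) ^ 4 = u ^ (4 * (p + 1)) by ring, ← e1]
    ring

theorem aux_lin {p n k : ℕ} {F : Type} [Field F] [Fintype F] [CharP F p] (hp : p.Prime)
    (hp7 : 7 ≤ p) (hF : Fintype.card F = p ^ 2) (hk : n = 4 + k * (p - 1))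
    (hc : ∑ x : F, (x + 1) ^ n * (x ^ n) ^ p ≠ 0)
    {ι : Type} [Fintype ι] (w u v : ι → ℤ) (ε : F) (hε : ε ^ p = - ε)
    (g : F → F) (hg : Function.Bijective g)
    (hgw : ∀ x, g x = ∑ i, (w i : F) * (x + ((u i : F) + v i * ε)) ^ n) :
    ∑ i, ∑ j, (w i * w j : F) * ((u i - u j : F) ^ 2 - (v i - v j : F) ^ 2 * ε ^ 2) ^ 4 = 0 := by
  have : Fact p.Prime := ⟨hp⟩
  have hint : ∀ z : ℤ, (z : F) ^ p = z := by
    intro z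
    exact map_intCast (frobenius F p) z
  have h0 : ∑ x, g x * g x ^ p = 0 := by
    have := aux_bij_sum g hg (p + 1) (by rw [hF]; have := Nat.mul_le_mul_right p hp7; rw [pow_two]; omega)
    simpa [pow_succ'] using this
  have h1 : ∀ x, g x * g x ^ p = ∑ i, ∑ j, (w i * w j : F) *
      ((x + ((u i : F) + v i * ε)) ^ n * ((x + ((u j : F) + v j * ε)) ^ n) ^ p) := by
    intro x
    have : g x ^ p = ∑ j, (w j : F) * ((x + ((u j : F) + v j * ε)) ^ n) ^ p := by
      rw [hgw, sum_pow_char]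
      refine Finset.sum_congr rfl fun j _ => ?_
      rw [mul_pow, hint]
    rw [this, hgw, Finset.sum_mul_sum]
    refine Finset.sum_congr rfl fun i _ => Finset.sum_congr rfl fun j _ => ?_
    ring
  simp_rw [h1] at h0
  rw [Finset.sum_comm] at h0
  simp_rw [Finset.sum_comm (s := (Finset.univ : Finset F)), ← Finset.mul_sum] at h0
  have h2 : ∀ i j, ∑ x : F, ((x + ((u i : F) + v i * ε)) ^ n * ((x + ((u j : F) + v j * ε)) ^ n) ^ p)
      = ((u i - u j : F) ^ 2 - (v i - v j : F) ^ 2 * ε ^ 2) ^ 4 *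
        ∑ x : F, (x + 1) ^ n * (x ^ n) ^ p := by
    intro i j
    have hN : (((u i : F) + v i * ε) - ((u j : F) + v j * ε)) ^ (p + 1) =
        ((u i - u j : F) ^ 2 - (v i - v j : F) ^ 2 * ε ^ 2) := by
      have : (((u i : F) + v i * ε) - ((u j : F) + v j * ε)) ^ p
          = (((u i : F) - v i * ε) - ((u j : F) - v j * ε)) := by
        rw [sub_pow_char, add_pow_char, add_pow_char, mul_pow, mul_pow, hint, hint, hint, hint, hε]
        ring
      rw [pow_succ, this]; ring
    rw [← hN, ← aux_corr hp hp7 hF hk]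
    rw [← Equiv.sum_comp (Equiv.addRight ((u j : F) + v j * ε))
      (fun x => (x + (((u i : F) + v i * ε) - ((u j : F) + v j * ε))) ^ n * (x ^ n) ^ p)]
    refine Finset.sum_congr rfl fun x _ => ?_
    simp only [Equiv.coe_addRight]
    congr 2
    ring
  simp_rw [h2, ← mul_assoc] at h0
  simp_rw [← Finset.sum_mul] at h0
  exact (mul_eq_zero.1 h0).resolve_right hc

theorem threePN_p_squared (p n : ℕ) (hp : p.Prime) (hp5 : 5 ≤ p)
    (hn0 : 0 < n) (hn : n ≤ p^2 - 1)
    (F : Type) [Field F] [Fintype F] (hF : Fintype.card F = p^2)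
    (h : IsKPN 3 (fun x : F => x^n)) : n = 4 ∨ n = 4 * p := by
  have hfact : Fact p.Prime := ⟨hp⟩
  have hchar : CharP F p := by
    obtain ⟨r, hr⟩ := CharP.exists F
    obtain ⟨m, hrp, hm⟩ := FiniteField.card F r
    rw [hF] at hm
    have : r ∣ p ^ 2 := by rw [hm]; exact dvd_pow_self r m.pos.ne'
    have := (Nat.prime_dvd_prime_iff_eq hrp hp).1 (hrp.dvd_of_dvd_pow this)
    rwa [← this]
  have H : ∀ a b c : F, a ≠ 0 → b ≠ 0 → c ≠ 0 →
      Function.Bijective (nabla c (nabla b (nabla a (fun x : F => x ^ n)))) := by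
    intro a b c ha hb hc
    exact h [a, b, c] rfl (by simp [ha, hb, hc])
  have D : ∀ x a b c d : F, a ≠ 0 → b ≠ 0 → c ≠ 0 → d ≠ 0 →
      nabla c (nabla b (nabla a (fun x : F => x ^ n))) (x + d) ≠
      nabla c (nabla b (nabla a (fun x : F => x ^ n))) x := by
    intro x a b c d ha hb hc hd he
    have := (H a b c ha hb hc).1 he
    exact hd (by simpa using this)
  -- restriction to the prime field
  obtain ⟨k, hk⟩ : ∃ k, n = 4 + k * (p - 1) := by
    apply aux_prime hp5 hn0
    intro a b c ha hb hc
    let φ : ZMod p →+* F := ZMod.castHom (dvd_refl p) F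
    have hφ : Function.Injective φ := φ.injective
    have hz : ∀ a : ZMod p, a ≠ 0 → φ a ≠ 0 := fun a ha => (map_ne_zero φ).2 ha
    apply Finite.injective_iff_bijective.1
    intro x y hxy
    apply hφ
    apply (H (φ a) (φ b) (φ c) (hz a ha) (hz b hb) (hz c hc)).1
    have := congrArg φ hxy
    simpa [nabla] using this
  -- the element ε
  obtain ⟨ε, hε0, hε⟩ : ∃ ε : F, ε ≠ 0 ∧ ε ^ p = - ε := by
    obtain ⟨z, hz⟩ : ∃ z : F, z ^ p ≠ z := by
      by_contra hcon
      push Not at hcon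
      have hb : Fintype.card F ≤ p := by
        let P : Polynomial F := Polynomial.X ^ p - Polynomial.X
        have hPd : P.natDegree = p := FiniteField.X_pow_card_sub_X_natDegree_eq F hp.one_lt
        have hP0 : P = 0 ∨ Fintype.card F ≤ p := by
          by_contra hh
          push Not at hh
          exact hh.1 (Polynomial.eq_zero_of_natDegree_lt_card_of_eval_eq_zero P
            (f := (id : F → F)) Function.injective_id (by intro i; simp [P, hcon]) (by omega))
        rcases hP0 with h0 | h0
        · rw [h0] at hPd; simp at hPd; omega
        · exact h0
      rw [hF, pow_two] at hb
      nlinarith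
    refine ⟨z - z ^ p, sub_ne_zero.2 hz.symm, ?_⟩
    have hx2 : z ^ (p * p) = z := by
      have := FiniteField.pow_card z
      rwa [hF, pow_two] at this
    rw [sub_pow_char, ← pow_mul, hx2]; ring
  have natne : ∀ j : ℕ, 0 < j → j < p → (j : F) ≠ 0 := by
    intro j h0 h1
    rw [Ne, CharP.cast_eq_zero_iff F p]
    exact Nat.not_dvd_of_pos_of_lt h0 h1
  have two0 : (2 : F) ≠ 0 := by have := natne 2 (by omega) (by omega); exact_mod_cast this
  have hint : ∀ z : ℤ, (z : F) ^ p = z := fun z => map_intCast (frobenius F p) z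
  have hεint : ∀ z : ℤ, ε ≠ z := by
    intro z hz
    have h1 := hint z
    rw [← hz, hε] at h1
    have : 2 * ε = 0 := by linear_combination -h1
    exact hε0 ((mul_eq_zero.1 this).resolve_left two0)
  -- digits
  obtain ⟨α, β, hα, hβ, hnab⟩ : ∃ α β, α < p ∧ β < p ∧ n = α + β * p := by
    refine ⟨n % p, n / p, Nat.mod_lt _ hp.pos, ?_, (Nat.mod_add_div' n p).symm⟩
    rw [Nat.div_lt_iff_lt_mul hp.pos, ← pow_two]
    have : 0 < p ^ 2 := by positivity
    omega
  have hs : α + β = 4 ∨ α + β = p + 3 := by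
    have e1 : (α + β) + β * (p - 1) = 4 + k * (p - 1) := by
      rw [← hk, hnab, Nat.mul_sub, Nat.mul_one]
      have : β ≤ β * p := Nat.le_mul_of_pos_right β hp.pos
      omega
    have hpos : 0 < α + β := by
      rcases Nat.eq_zero_or_pos (α + β) with h0 | h0
      · have h1 : α = 0 := by omega
        have h2 : β = 0 := by omega
        subst h1 h2; simp at hnab; omega
      · exact h0
    obtain ⟨P, hP⟩ : ∃ P, p = P + 1 := ⟨p - 1, by omega⟩
    rw [hP, Nat.add_sub_cancel] at e1
    rcases Nat.lt_trichotomy β k with hlt | heq | hgt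
    · obtain ⟨t, rfl⟩ : ∃ t, k = β + 1 + t := ⟨k - β - 1, by omega⟩
      have e2 : α + β = 4 + P + t * P := by nlinarith
      rcases Nat.eq_zero_or_pos t with h0 | h0
      · subst h0; omega
      · have := Nat.le_mul_of_pos_left P h0
        omega
    · subst heq; omega
    · obtain ⟨t, rfl⟩ : ∃ t, β = k + 1 + t := ⟨β - k - 1, by omega⟩
      have e2 : α + (k + 1 + t) + P + t * P = 4 := by nlinarith
      omega
  have fx : ∀ u v : ℤ, ((u : F) + v * ε) ^ n = ((u : F) + v * ε) ^ α * ((u : F) - v * ε) ^ β := by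
    intro u v
    rw [hnab, pow_add, mul_comm β p, pow_mul, add_pow_char (p := p), mul_pow, hint, hint, hε]
    ring
  rcases hs with hs | hs
  · -- few digits
    have F1 := fun u v : ℤ => fx u v
    have hcase : (α = 4 ∧ β = 0) ∨ (α = 3 ∧ β = 1) ∨ (α = 2 ∧ β = 2) ∨ (α = 1 ∧ β = 3) ∨
      (α = 0 ∧ β = 4) := by omega
    have D1 := D 0 1 1 ε ε one_ne_zero one_ne_zero hε0 hε0
    have D2 := D 0 1 1 1 ε one_ne_zero one_ne_zero one_ne_zero hε0
    have G : ∀ (y : F) (u v : ℤ), y = (u : F) + v * ε → y ^ n = ((u : F) + v * ε) ^ α * ((u : F) - v * ε) ^ β := by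
      rintro y u v rfl; exact fx u v
    simp only [nabla] at D1 D2
    rw [G (0 + ε + ε + 1 + 1) 2 2 (by push_cast; ring), G (0 + ε + ε + 1) 1 2 (by push_cast; ring),
      G (0 + ε + ε) 0 2 (by push_cast; ring), G (0 + ε + 1 + 1) 2 1 (by push_cast; ring),
      G (0 + ε + 1) 1 1 (by push_cast; ring), G (0 + ε) 0 1 (by push_cast; ring),
      G (0 + 1 + 1) 2 0 (by push_cast; ring), G (0 + 1) 1 0 (by push_cast; ring),
      G 0 0 0 (by push_cast; ring)] at D1
    rw [G (0 + ε + 1 + 1 + 1) 3 1 (by push_cast; ring), G (0 + ε + 1 + 1) 2 1 (by push_cast; ring),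
      G (0 + ε + 1) 1 1 (by push_cast; ring), G (0 + ε) 0 1 (by push_cast; ring),
      G (0 + 1 + 1 + 1) 3 0 (by push_cast; ring),
      G (0 + 1 + 1) 2 0 (by push_cast; ring), G (0 + 1) 1 0 (by push_cast; ring),
      G 0 0 0 (by push_cast; ring)] at D2
    rcases hcase with ⟨rfl, rfl⟩ | ⟨rfl, rfl⟩ | ⟨rfl, rfl⟩ | ⟨rfl, rfl⟩ | ⟨rfl, rfl⟩
    · left; omega
    · exfalso; apply D1; push_cast; ring
    · exfalso; apply D2; push_cast; ring
    · exfalso; apply D1; push_cast; ring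
    · right; omega
  · exfalso
    rcases Nat.lt_or_ge p 7 with h7 | hp7
    · have hp5' : p = 5 := by
        interval_cases p
        · rfl
        · exact absurd hp (by norm_num)
      subst hp5'
      have h24 : n = Fintype.card F - 1 := by rw [hF]; omega
      have hone : ∀ z : ℤ, (ε + z) ^ n = 1 := by
        intro z
        rw [h24]
        apply FiniteField.pow_card_sub_one_eq_one
        intro h0
        apply hεint (-z)
        push_cast
        linear_combination h0
      have D1 := D ε 1 1 1 1 one_ne_zero one_ne_zero one_ne_zero one_ne_zero
      have G : ∀ (y : F) (z : ℤ), y = ε + z → y ^ n = 1 := by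
        rintro y z rfl; exact hone z
      apply D1
      simp only [nabla]
      rw [G (ε + 1 + 1 + 1 + 1) 4 (by push_cast; ring), G (ε + 1 + 1 + 1) 3 (by push_cast; ring),
        G (ε + 1 + 1) 2 (by push_cast; ring), G (ε + 1) 1 (by push_cast; ring),
        G ε 0 (by push_cast; ring)]
    · have hc := aux_c_ne (F := F) hp hp7 hF hnab hα hβ hs
      have hA := aux_lin hp hp7 hF hk hc (ι := Fin 6) ![-1, 2, -1, 1, -2, 1] ![0, 1, 2, 0, 1, 2]
        ![0, 0, 0, 1, 1, 1] ε hε _ (H 1 1 ε one_ne_zero one_ne_zero hε0) (by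
          intro x
          simp [nabla, Fin.sum_univ_succ]
          ring_nf)
      have hA' : 96 * ε ^ 2 * (3 * ε ^ 2 - 10) = 0 := by
        simp [Fin.sum_univ_succ] at hA
        ring_nf at hA ⊢
        first
          | linear_combination hA
          | linear_combination -hA
      rcases Nat.lt_or_ge p 11 with h11 | hp11
      · have hp7' : p = 7 := by
          interval_cases p
          · rfl
          · exact absurd hp (by norm_num)
          · exact absurd hp (by norm_num)
          · exact absurd hp (by norm_num)
        subst hp7'
        have h70 : (7 : F) = 0 := by exact_mod_cast CharP.cast_eq_zero F 7
        have : (ε - ((1 : ℤ) : F)) * (ε + 1) * (ε ^ 2) = 0 := by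
          push_cast
          -- 96 * 3 = 288 = 1 mod 7, 960 = 1 mod 7
          linear_combination hA' - (41 * ε ^ 4 - 137 * ε ^ 2) * h70
        rcases mul_eq_zero.1 this with h1 | h1
        · rcases mul_eq_zero.1 h1 with h2 | h2
          · exact hεint 1 (sub_eq_zero.1 h2)
          · exact hεint (-1) (by push_cast; linear_combination h2)
        · exact hε0 (pow_eq_zero_iff (two_ne_zero) |>.1 h1)
      · have hB := aux_lin hp hp7 hF hk hc (ι := Fin 4) ![-1, 3, -3, 1] ![0, 1, 2, 3]
          ![0, 0, 0, 0] ε hε _ (H 1 1 1 one_ne_zero one_ne_zero one_ne_zero) (by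
            intro x
            simp [nabla, Fin.sum_univ_succ]
            ring_nf)
        have hB' : (10080 : F) = 0 := by
          simp [Fin.sum_univ_succ] at hB
          ring_nf at hB ⊢
          first
            | linear_combination hB
            | linear_combination -hB
        have hd : p ∣ 10080 := by
          rw [← CharP.cast_eq_zero_iff F p]; exact_mod_cast hB'
        have hd2 : p ∣ 2 ^ 5 * 3 ^ 2 * 5 * 7 := by norm_num; exact hd
        rcases (Nat.Prime.dvd_mul hp).1 hd2 with h1 | h1
        · rcases (Nat.Prime.dvd_mul hp).1 h1 with h1 | h1
          · rcases (Nat.Prime.dvd_mul hp).1 h1 with h1 | h1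
            · have := Nat.le_of_dvd (by norm_num) (hp.dvd_of_dvd_pow h1); omega
            · have := Nat.le_of_dvd (by norm_num) (hp.dvd_of_dvd_pow h1); omega
          · have := Nat.le_of_dvd (by norm_num) h1; omega
        · have := Nat.le_of_dvd (by norm_num) h1; omega
end

section
/- Let p \geq 5 be a prime and n \leq p^2 - 1 a positive integer. If x^n is 2-PN over \mathbb{F}_{p^2}, then: if p \equiv -1 \pmod 3 then n \in \{3, 3p\}, and if p \equiv 1 \pmod 3 then n \in \{3, 3p, 1+2p, 2+p\}. -/
open Finset

/-- second difference in the form used by `nablaIter [a,b]` -/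
def SecPN (K : Type) [Field K] (n : ℕ) : Prop :=
  ∀ a b : K, a ≠ 0 → b ≠ 0 →
    Function.Bijective (fun x : K => ((x + b + a)^n - (x + b)^n) - ((x + a)^n - x^n))

lemma secPN_of_isKPN {F : Type} [Field F] {n : ℕ} (h : IsKPN 2 (fun x : F => x^n)) :
    SecPN F n := by
  intro a b ha hb
  have := h [a, b] rfl (by simp [ha, hb])
  exact this

lemma sum_pow_eq {K : Type} [Field K] [Fintype K] (i : ℕ) (hi : 0 < i) :
    ∑ x : K, x ^ i = if (Fintype.card K - 1) ∣ i then -1 else 0 := by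
  classical
  rw [← FiniteField.sum_pow_units K i]
  rw [← Fintype.sum_subtype_add_sum_subtype (fun x : K => x ≠ 0)]
  have h2 : ∑ x : {x : K // ¬ x ≠ 0}, (x : K) ^ i = 0 := by
    apply Finset.sum_eq_zero
    rintro ⟨x, hx⟩ _
    have : x = 0 := by simpa using hx
    simp [this, hi.ne']
  rw [h2, add_zero]
  symm
  apply Fintype.sum_equiv unitsEquivNeZero
  intro x
  simp

lemma sum_poly {K : Type} [Field K] [Fintype K] (P : Polynomial K)
    (hP : P.natDegree ≤ Fintype.card K - 1) :
    ∑ x : K, P.eval x = - P.coeff (Fintype.card K - 1) := by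
  have hc : 1 < Fintype.card K := Fintype.one_lt_card
  have : ∀ x : K, P.eval x = ∑ i ∈ range (Fintype.card K - 1 + 1), P.coeff i * x ^ i :=
    fun x => Polynomial.eval_eq_sum_range' (by omega) x
  simp_rw [this]
  rw [sum_comm]
  simp_rw [← mul_sum]
  rw [sum_range_succ]
  rw [sum_eq_zero]
  · rw [sum_pow_eq _ (by omega)]
    simp
  · intro i hi
    rw [FiniteField.sum_pow_lt_card_sub_one K i (by simpa using hi), mul_zero]

/-- correlation identity -/
lemma corr_identity {K : Type} [Field K] [Fintype K] (f g : K → K) (C : K → K)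
    (hC : ∀ t, ∑ x, f (x + t) * g x = C t) (a b : K) :
    ∑ x, ((f (x + b + a) - f (x + b)) - (f (x + a) - f x)) *
         ((g (x + b + a) - g (x + b)) - (g (x + a) - g x)) =
    4 * C 0 - 2 * C a - 2 * C (-a) - 2 * C b - 2 * C (-b) + C (a + b) + C (-(a+b))
      + C (a - b) + C (b - a) := by
  have key : ∀ u v : K, ∑ x, f (x + u) * g (x + v) = C (u - v) := by
    intro u v
    rw [← hC]
    rw [← Equiv.sum_comp (Equiv.addRight v) (fun x => f (x + (u - v)) * g x)]
    apply sum_congr rfl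
    intro x _
    simp only [Equiv.coe_addRight]
    congr 2
    ring
  have e : ∀ x, ((f (x + b + a) - f (x + b)) - (f (x + a) - f x)) *
         ((g (x + b + a) - g (x + b)) - (g (x + a) - g x)) =
      f (x + (b+a)) * g (x + (b+a)) - f (x + (b+a)) * g (x + b) - f (x + (b+a)) * g (x + a)
      + f (x + (b+a)) * g (x + 0)
      - f (x + b) * g (x + (b+a)) + f (x + b) * g (x + b) + f (x + b) * g (x + a)
      - f (x + b) * g (x + 0)
      - f (x + a) * g (x + (b+a)) + f (x + a) * g (x + b) + f (x + a) * g (x + a)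
      - f (x + a) * g (x + 0)
      + f (x + 0) * g (x + (b+a)) - f (x + 0) * g (x + b) - f (x + 0) * g (x + a)
      + f (x + 0) * g (x + 0) := by
    intro x
    simp only [add_zero, ← add_assoc]
    ring
  simp only [e, sum_add_distrib, sum_sub_distrib, key]
  have h1 : b + a - (b + a) = 0 := by ring
  have h2 : b + a - b = a := by ring
  have h3 : b + a - a = b := by ring
  have h4 : b - (b + a) = -a := by ring
  have h5 : a - (b + a) = -b := by ring
  have h6 : b + a = a + b := by ring
  simp only [h1, h2, h3, h4, h5, sub_zero, zero_sub, sub_self]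
  rw [h6]
  ring

/-- moments of a planar function vanish up to half -/
lemma planar_moments {p : ℕ} [Fact p.Prime] (g : ZMod p → ZMod p)
    (hg : ∀ d : ZMod p, d ≠ 0 → Function.Bijective (fun y => g (y + d) - g y))
    (r : ℕ) (hr : 2 * r < p - 1) : ∑ x, (g x) ^ r = 0 := by
  induction r using Nat.strong_induction_on with
  | _ r ih =>
  rcases Nat.eq_zero_or_pos r with rfl | hpos
  · simp
  have hdouble : ∑ x : ZMod p, ∑ y : ZMod p, (g x + - g y) ^ (2 * r) = 0 := by
    rw [sum_comm]
    have : ∀ y : ZMod p, ∑ x : ZMod p, (g x + - g y) ^ (2 * r)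
        = ∑ d : ZMod p, (g (y + d) - g y) ^ (2 * r) := by
      intro y
      rw [← Equiv.sum_comp (Equiv.addLeft y)]
      simp [sub_eq_add_neg]
    simp_rw [this]
    rw [sum_comm]
    apply sum_eq_zero
    intro d _
    by_cases hd : d = 0
    · subst hd
      simp [hpos.ne']
    · rw [(hg d hd).sum_comp (fun z => z ^ (2 * r))]
      apply FiniteField.sum_pow_lt_card_sub_one
      rw [ZMod.card]; exact hr
  have hexp : ∑ x : ZMod p, ∑ y : ZMod p, (g x + - g y) ^ (2 * r) =
      ∑ j ∈ range (2 * r + 1), (∑ x, g x ^ j) * ((-1) ^ (2 * r - j) * ∑ y, g y ^ (2 * r - j))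
        * ((2 * r).choose j : ZMod p) := by
    simp_rw [add_pow]
    simp_rw [sum_comm (s := univ) (t := range (2 * r + 1))]
    apply sum_congr rfl
    intro j _
    rw [mul_sum, sum_mul_sum, sum_mul]
    apply sum_congr rfl
    intro x _
    rw [sum_mul]
    apply sum_congr rfl
    intro y _
    rw [neg_pow]
  rw [hexp, sum_eq_single r] at hdouble
  · have h2 : 2 * r - r = r := by omega
    rw [h2] at hdouble
    have hch : ((2 * r).choose r : ZMod p) ≠ 0 := by
      rw [Ne, ZMod.natCast_eq_zero_iff]
      intro hdvd
      have h3 : p ∣ (2 * r).factorial := by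
        rw [← Nat.choose_mul_factorial_mul_factorial (show r ≤ 2 * r by omega)]
        exact Dvd.dvd.mul_right (Dvd.dvd.mul_right hdvd _) _
      rw [(Fact.out : p.Prime).dvd_factorial] at h3
      omega
    have h4 : ((-1 : ZMod p)) ^ r ≠ 0 := pow_ne_zero _ (by simp)
    simpa [hch, h4] using hdouble
  · intro j hj hjr
    rcases lt_or_gt_of_ne hjr with h5 | h5
    · rw [ih j h5 (by omega)]; simp
    · have : j < 2 * r + 1 := by simpa using hj
      rw [ih (2 * r - j) (by omega) (by omega)]; simp
  · intro h; exfalso; simp at h <;> omega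

lemma planar_mixed {p : ℕ} [Fact p.Prime] (h : ZMod p → ZMod p)
    (hg : ∀ d : ZMod p, d ≠ 0 → Function.Bijective (fun y => h (y + d) - h y))
    (i j : ℕ) (hr : 2 * (i + j) < p - 1) : ∑ x, h x ^ i * x ^ j = 0 := by
  have hp := (Fact.out : p.Prime)
  have hS : ∀ c : ZMod p, ∑ x, (c * x + h x) ^ (i + j) = 0 := by
    intro c
    apply planar_moments (fun x => c * x + h x) _ _ hr
    intro d hd
    have : (fun y => (c * (y + d) + h (y + d)) - (c * y + h y)) =
      (fun z => z + c * d) ∘ (fun y => h (y + d) - h y) := by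
      funext y; simp; ring
    rw [this]
    exact (Equiv.addRight (c * d)).bijective.comp (hg d hd)
  let P : Polynomial (ZMod p) := ∑ l ∈ range (i + j + 1),
    Polynomial.C ((∑ x, x ^ l * h x ^ (i + j - l)) * ((i + j).choose l : ZMod p)) * Polynomial.X ^ l
  have hP : P = 0 := by
    apply Polynomial.eq_zero_of_natDegree_lt_card_of_eval_eq_zero P Function.injective_id
    · intro c
      rw [← hS c]
      simp only [P, Polynomial.eval_finsetSum, id, Polynomial.eval_mul, Polynomial.eval_C,
        Polynomial.eval_pow, Polynomial.eval_X, add_pow]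
      rw [sum_comm]
      apply sum_congr rfl
      intro l _
      rw [sum_mul, sum_mul]
      apply sum_congr rfl
      intro x _
      rw [mul_pow]; ring
    · rw [ZMod.card]
      apply lt_of_le_of_lt (Polynomial.natDegree_sum_le_of_forall_le (n := i + j) _ _ _)
      · omega
      · intro l hl
        have : l < i + j + 1 := by simpa using hl
        exact (Polynomial.natDegree_C_mul_X_pow_le _ _).trans (by omega)
  have hc := congrArg (fun Q => Polynomial.coeff Q j) hP
  simp only [P, Polynomial.finsetSum_coeff, Polynomial.coeff_C_mul, Polynomial.coeff_X_pow,
    Polynomial.coeff_zero] at hc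
  rw [sum_eq_single j] at hc
  · have hch : ((i + j).choose j : ZMod p) ≠ 0 := by
      rw [Ne, ZMod.natCast_eq_zero_iff]
      intro hdvd
      have h3 : p ∣ (i + j).factorial := by
        rw [← Nat.choose_mul_factorial_mul_factorial (show j ≤ i + j by omega)]
        exact Dvd.dvd.mul_right (Dvd.dvd.mul_right hdvd _) _
      rw [hp.dvd_factorial] at h3
      omega
    have h6 : i + j - j = i := by omega
    rw [h6] at hc
    simp [hch] at hc
    simpa [mul_comm] using hc
  · intro l _ hl
    simp [Ne.symm hl]
  · intro h; exfalso; simp at h <;> omega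

lemma natCast_choose_ne {K : Type} [Field K] {p : ℕ} [CharP K p] (hp : p.Prime) {m k : ℕ}
    (hk : k ≤ m) (hm : m < p) : ((m.choose k : ℕ) : K) ≠ 0 := by
  rw [Ne, CharP.cast_eq_zero_iff K p]
  intro hdvd
  have h3 : p ∣ m.factorial := by
    rw [← Nat.choose_mul_factorial_mul_factorial hk]
    exact Dvd.dvd.mul_right (Dvd.dvd.mul_right hdvd _) _
  rw [hp.dvd_factorial] at h3
  omega

/-- prime field, the exceptional exponent -/
lemma prime_exceptional {p : ℕ} [Fact p.Prime] (hp7 : 7 ≤ p) (m : ℕ) (hm : 2 * m = p + 3)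
    (H : SecPN (ZMod p) m) : False := by
  have hp := (Fact.out : p.Prime)
  have hC : ∀ t : ZMod p, ∑ x : ZMod p, (x + t) ^ m * x ^ m = -(m.choose 4 : ZMod p) * t ^ 4 := by
    intro t
    simp_rw [add_pow, sum_mul]
    rw [sum_comm, sum_eq_single (m - 4)]
    · have e : ∀ x : ZMod p, x ^ (m - 4) * t ^ (m - (m - 4)) * (m.choose (m - 4) : ZMod p) * x ^ m
          = (t ^ 4 * (m.choose 4 : ZMod p)) * x ^ (p - 1) := by
        intro x
        have h1 : m - (m - 4) = 4 := by omega
        have h2 : p - 1 = (m - 4) + m := by omega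
        rw [Nat.choose_symm (by omega), h1, h2, pow_add]; ring
      simp_rw [e]
      rw [← mul_sum, sum_pow_eq _ (by omega), ZMod.card]
      simp; ring
    · intro j hj hne
      have hj' : j < m + 1 := by simpa using hj
      have e : ∀ x : ZMod p, x ^ j * t ^ (m - j) * (m.choose j : ZMod p) * x ^ m
          = (t ^ (m - j) * (m.choose j : ZMod p)) * x ^ (j + m) := by
        intro x; rw [pow_add]; ring
      simp_rw [e]
      rw [← mul_sum, sum_pow_eq _ (by omega), ZMod.card, if_neg, mul_zero]
      rintro ⟨c, hc⟩
      have : c < 2 := by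
        by_contra hcc
        have : (p - 1) * 2 ≤ (p - 1) * c := Nat.mul_le_mul_left _ (by omega)
        omega
      interval_cases c <;> omega
    · intro h; exfalso; simp at h <;> omega
  have h1 := corr_identity (fun x : ZMod p => x ^ m) (fun x => x ^ m) _ hC 1 1
  have h2 := (H 1 1 one_ne_zero one_ne_zero).sum_comp (fun z => z ^ 2)
  rw [FiniteField.sum_pow_lt_card_sub_one _ _ (by rw [ZMod.card]; omega)] at h2
  simp only [pow_two] at h2
  rw [h2] at h1
  have h3 : (24 : ZMod p) * (m.choose 4 : ZMod p) = 0 := by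
    linear_combination h1
  have h4 : (m.choose 4 : ZMod p) ≠ 0 := natCast_choose_ne hp (by omega) (by omega)
  have h5 : (24 : ZMod p) = 0 := by simpa [h4] using h3
  have h6 : ((24 : ℕ) : ZMod p) = 0 := by exact_mod_cast h5
  rw [ZMod.natCast_eq_zero_iff] at h6
  have h7 : (24:ℕ) = 2 ^ 3 * 3 := by norm_num
  rw [h7, hp.dvd_mul] at h6
  rcases h6 with h6 | h6
  · have := Nat.le_of_dvd (by norm_num) (hp.dvd_of_dvd_pow h6); omega
  · have := Nat.le_of_dvd (by norm_num) h6; omega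

lemma arith_aux (p d : ℕ) (hd4 : 4 ≤ d) (hdp : d + 3 ≤ p) (hex : 2 * d ≠ p + 1)
    (hpodd : p % 2 = 1) :
    ∃ i j, i * d + j = p - 1 ∧ 2 * (i + j) < p - 1 := by
  refine ⟨(p - 1) / d, (p - 1) % d, Nat.div_add_mod' _ _, ?_⟩
  have h1 := Nat.div_add_mod' (p - 1) d
  have h2 := Nat.mod_lt (p - 1) (show d > 0 by omega)
  generalize (p - 1) / d = i at *
  generalize (p - 1) % d = j at *
  have hi : 1 ≤ i := by
    by_contra h
    have : i = 0 := by omega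
    rw [this] at h1; omega
  rcases Nat.eq_or_lt_of_le hi with h | h
  · rw [← h] at h1 ⊢
    omega
  · obtain ⟨e, rfl⟩ : ∃ e, d = e + 2 := ⟨d - 2, by omega⟩
    nlinarith

lemma prime_case {p : ℕ} [Fact p.Prime] (hp5 : 5 ≤ p) (m : ℕ) (hm0 : 0 < m) (hm : m ≤ p - 1)
    (H : SecPN (ZMod p) m) : m = 3 := by
  have hp := (Fact.out : p.Prime)
  have hpodd : p % 2 = 1 := by
    rcases hp.eq_two_or_odd with h | h <;> omega
  have h2ne : (2 : ZMod p) ≠ 0 := by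
    intro h
    have h6 : ((2 : ℕ) : ZMod p) = 0 := by exact_mod_cast h
    rw [ZMod.natCast_eq_zero_iff] at h6
    have := Nat.le_of_dvd (by norm_num) h6; omega
  have H11 := (H 1 1 one_ne_zero one_ne_zero).injective
  have hodd : m % 2 = 1 := by
    by_contra hev
    have hev' : Even m := by rw [Nat.even_iff]; omega
    have h0 : (0 : ZMod p) = -2 := by
      apply H11
      have e1 : (-2 + 1 + 1 : ZMod p) = 0 := by ring
      have e2 : (-2 + 1 : ZMod p) = -1 := by ring
      simp only [e1, e2, hev'.neg_pow]
      have e3 : (0 + 1 + 1 : ZMod p) = 2 := by ring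
      rw [e3]; ring
    apply h2ne
    linear_combination h0
  have hm1 : m ≠ 1 := by
    rintro rfl
    have : (0 : ZMod p) = 1 := H11 (by simp)
    exact zero_ne_one this
  by_contra hm3
  have hm5 : 5 ≤ m := by omega
  by_cases hex : 2 * m = p + 3
  · exact prime_exceptional (by omega) m hex H
  obtain ⟨i, j, hij, hlt⟩ := arith_aux p (m - 1) (by omega) (by omega) (by omega) hpodd
  let h : Polynomial (ZMod p) := (Polynomial.X + 1) ^ m - Polynomial.X ^ m
  have hh : ∀ x, h.eval x = (x + 1) ^ m - x ^ m := by intro x; simp [h]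
  have hsum := planar_mixed (fun x => h.eval x) (by
    intro d hd
    simp only [hh]
    exact H 1 d one_ne_zero hd) i j hlt
  have hdeg : h.natDegree ≤ m - 1 := by
    have hdl : h.degree < ((Polynomial.X + 1 : Polynomial (ZMod p)) ^ m).degree := by
      have hmon : ((Polynomial.X + 1 : Polynomial (ZMod p))).Monic := by
        simpa using Polynomial.monic_X_add_C (1 : ZMod p)
      apply Polynomial.degree_sub_lt_left
      · have : (Polynomial.X + 1 : Polynomial (ZMod p)).degree = 1 := by
          simpa using Polynomial.degree_X_add_C (1 : ZMod p)
        rw [Polynomial.degree_pow, this, Polynomial.degree_X_pow]; simp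
      · exact (hmon.pow m).ne_zero
      · rw [(hmon.pow m).leadingCoeff, (Polynomial.monic_X_pow m).leadingCoeff]
    have : (Polynomial.X + 1 : Polynomial (ZMod p)).degree = 1 := by
      simpa using Polynomial.degree_X_add_C (1 : ZMod p)
    rw [Polynomial.degree_pow, this] at hdl
    rw [Polynomial.natDegree_le_iff_degree_le]
    by_cases h0 : h = 0
    · rw [h0]; simp
    · rw [Polynomial.degree_eq_natDegree h0] at hdl ⊢
      simp only [nsmul_eq_mul, mul_one] at hdl
      have : h.natDegree < m := by exact_mod_cast hdl
      exact_mod_cast (by omega : h.natDegree ≤ m - 1)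
  have hcoef : h.coeff (m - 1) = m := by
    simp only [h, Polynomial.coeff_sub, Polynomial.coeff_X_add_one_pow, Polynomial.coeff_X_pow]
    rw [if_neg (by omega), sub_zero]
    have : m.choose (m - 1) = m := by
      rw [Nat.choose_symm (by omega : 1 ≤ m), Nat.choose_one_right]
    rw [this]
  have hPdeg : (h ^ i * Polynomial.X ^ j).natDegree ≤ Fintype.card (ZMod p) - 1 := by
    rw [ZMod.card, ← hij]
    refine Polynomial.natDegree_mul_le.trans (add_le_add ?_ (Polynomial.natDegree_X_pow_le _))
    exact Polynomial.natDegree_pow_le.trans (Nat.mul_le_mul_left _ hdeg)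
  have hs2 := sum_poly _ hPdeg
  simp only [Polynomial.eval_mul, Polynomial.eval_pow, Polynomial.eval_X] at hs2
  rw [hsum, ZMod.card, ← hij, Polynomial.coeff_mul_X_pow,
    Polynomial.coeff_pow_of_natDegree_le hdeg, hcoef] at hs2
  have hmne : (m : ZMod p) ≠ 0 := by
    rw [Ne, ZMod.natCast_eq_zero_iff]
    intro hd
    have := Nat.le_of_dvd (by omega) hd; omega
  exact pow_ne_zero i hmne (by linear_combination hs2)

lemma restrict_prime {p n : ℕ} [Fact p.Prime] {F : Type} [Field F] [CharP F p]
    (H : SecPN F n) : SecPN (ZMod p) n := by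
  intro a b ha hb
  let φ : ZMod p →+* F := ZMod.castHom (dvd_refl p) F
  have hφ : Function.Injective φ := φ.injective
  rw [← Finite.injective_iff_bijective]
  intro x y hxy
  apply hφ
  apply (H (φ a) (φ b) (by simpa using ha) (by simpa using hb)).injective
  have := congrArg φ hxy
  simpa using this

lemma mod_case {p n : ℕ} [Fact p.Prime] (hp5 : 5 ≤ p) (hn0 : 0 < n)
    (H : SecPN (ZMod p) n) : ∃ l, n = 3 + (p - 1) * l := by
  have hp := (Fact.out : p.Prime)
  let m := (n - 1) % (p - 1) + 1
  have hdm := Nat.mod_add_div (n - 1) (p - 1)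
  have hlt := Nat.mod_lt (n - 1) (show p - 1 > 0 by omega)
  have hn : n = m + (p - 1) * ((n - 1) / (p - 1)) := by omega
  have hpow : ∀ x : ZMod p, x ^ n = x ^ m := by
    intro x
    by_cases hx : x = 0
    · subst hx
      rw [zero_pow (by omega), zero_pow (by omega)]
    · rw [hn, pow_add, pow_mul, ZMod.pow_card_sub_one_eq_one hx, one_pow, mul_one]
  have Hm : SecPN (ZMod p) m := by
    intro a b ha hb
    have := H a b ha hb
    simpa only [hpow] using this
  have h3 := prime_case hp5 m (by omega) (by omega) Hm
  exact ⟨(n - 1) / (p - 1), by omega⟩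

/-- the case of digit sum `p+2` -/
lemma big_case {p n0 n1 : ℕ} [Fact p.Prime] (hp5 : 5 ≤ p) {F : Type} [Field F] [Fintype F]
    [CharP F p] (hF : Fintype.card F = p ^ 2) (h0 : n0 < p) (h1 : n1 < p)
    (hs : n0 + n1 = p + 2) (H : SecPN F (n0 + p * n1)) : False := by
  have hp := (Fact.out : p.Prime)
  have hpp : ∀ x : F, (x ^ p) ^ p = x := by
    intro x
    rw [← pow_mul, ← pow_two, ← hF, FiniteField.pow_card]
  have hfr : ∀ x y : F, (x + y) ^ p = x ^ p + y ^ p := fun x y => add_pow_char x y p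
  let κ : F := (n0.choose 3 : F) * (n1.choose 3 : F)
  have hκ : κ ≠ 0 := mul_ne_zero (natCast_choose_ne hp (by omega) h0)
    (natCast_choose_ne hp (by omega) h1)
  have hq : p ^ 2 - 1 = (p - 1) + p * (p - 1) := by
    obtain ⟨r, rfl⟩ : ∃ r, p = r + 1 := ⟨p - 1, by omega⟩
    simp only [Nat.add_sub_cancel]
    have : (r + 1) ^ 2 = r + (r + 1) * r + 1 := by ring
    omega
  have hC : ∀ t : F, ∑ x : F, (x + t) ^ (n0 + p * n1) * ((x ^ (n0 + p * n1)) ^ p)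
      = -κ * (t ^ 3 * (t ^ p) ^ 3) := by
    intro t
    have e : ∀ x : F, (x + t) ^ (n0 + p * n1) * ((x ^ (n0 + p * n1)) ^ p) =
        ∑ i ∈ range (n0 + 1), ∑ j ∈ range (n1 + 1),
          (t ^ (n0 - i) * (n0.choose i : F) * ((t ^ p) ^ (n1 - j) * (n1.choose j : F))) *
            x ^ ((i + n1) + p * (j + n0)) := by
      intro x
      have e2 : (x ^ (n0 + p * n1)) ^ p = (x ^ p) ^ n0 * x ^ n1 := by
        rw [pow_right_comm, pow_add, pow_mul, hpp]
      rw [e2, pow_add, pow_mul, hfr, add_pow, add_pow, sum_mul_sum, sum_mul]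
      apply sum_congr rfl
      intro i _
      rw [sum_mul]
      apply sum_congr rfl
      intro j _
      rw [pow_add x (i + n1), pow_mul x, pow_add, pow_add]
      ring
    simp_rw [e]
    rw [sum_comm]
    simp_rw [sum_comm (s := univ), ← mul_sum]
    have hz : ∀ i j, i < n0 + 1 → j < n1 + 1 → ¬ (i = n0 - 3 ∧ j = n1 - 3) →
        ∑ x : F, x ^ ((i + n1) + p * (j + n0)) = 0 := by
      intro i j hi hj hne
      rw [sum_pow_eq _ (by omega), hF, if_neg]
      rintro ⟨c, hc⟩
      rw [hq] at hc
      apply hne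
      obtain ⟨r, rfl⟩ : ∃ r, p = r + 1 := ⟨p - 1, by omega⟩
      simp only [Nat.add_sub_cancel] at hc
      have hu : i + n1 ≤ r + 3 := by omega
      have hv : j + n0 ≤ r + 3 := by omega
      have hv2 : 3 ≤ j + n0 := by omega
      have hu2 : 3 ≤ i + n1 := by omega
      generalize hU : i + n1 = u at *
      generalize hV : j + n0 = v at *
      have hc2 : c < 2 := by
        by_contra hcc
        have : (r + (r + 1) * r) * 2 ≤ (r + (r + 1) * r) * c := Nat.mul_le_mul_left _ (by omega)
        nlinarith
      have hc0 : c ≠ 0 := by rintro rfl; simp at hc; omega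
      have hc1 : c = 1 := by omega
      subst hc1
      have hvr : v = r := by
        rcases lt_trichotomy v r with h | h | h
        · exfalso
          have : (r + 1) * (v + 1) ≤ (r + 1) * r := Nat.mul_le_mul_left _ h
          have h9 : (r + 1) * (v + 1) = (r + 1) * v + r + 1 := by ring
          omega
        · exact h
        · exfalso
          have : (r + 1) * (r + 1) ≤ (r + 1) * v := Nat.mul_le_mul_left _ h
          have h9 : (r + 1) * (r + 1) = (r + 1) * r + r + 1 := by ring
          omega
      subst hvr
      omega
    rw [sum_eq_single (n0 - 3)]
    · rw [sum_eq_single (n1 - 3)]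
      · have h4 : n0 - 3 + n1 + p * (n1 - 3 + n0) = (p ^ 2 - 1) := by
          rw [hq]
          have a1 : n0 - 3 + n1 = p - 1 := by omega
          have a2 : n1 - 3 + n0 = p - 1 := by omega
          rw [a1, a2]
        rw [h4, sum_pow_eq _ (by rw [hq]; omega), hF, if_pos (dvd_refl _),
          Nat.choose_symm (by omega : 3 ≤ n0), Nat.choose_symm (by omega : 3 ≤ n1)]
        have a1 : n0 - (n0 - 3) = 3 := by omega
        have a2 : n1 - (n1 - 3) = 3 := by omega
        rw [a1, a2]
        simp only [κ]; ring
      · intro j hj hne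
        rw [hz _ _ (by omega) (by simpa using hj) (by tauto), mul_zero]
      · intro h; exfalso; simp at h <;> omega
    · intro i hi hne
      apply sum_eq_zero
      intro j hj
      rw [hz _ _ (by simpa using hi) (by simpa using hj) (by tauto), mul_zero]
    · intro h; exfalso; simp at h <;> omega
  obtain ⟨a, ha0, ha⟩ : ∃ a : F, a ≠ 0 ∧ a ^ p = -a := by
    obtain ⟨g, hg⟩ := IsCyclic.exists_ofOrder_eq_natCard (α := Fˣ)
    have hcard : Nat.card Fˣ = p ^ 2 - 1 := by
      rw [Nat.card_units, Nat.card_eq_fintype_card, hF]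
    have hex : (g : F) ^ p ≠ g := by
      intro hgg
      have h2 : g ^ (p - 1) = 1 := by
        have : g ^ (p - 1) * g = 1 * g := by
          rw [← pow_succ, Nat.sub_add_cancel (by omega), one_mul]
          ext; simpa using hgg
        exact mul_right_cancel this
      have h3 := orderOf_dvd_of_pow_eq_one h2
      rw [hg, hcard, hq] at h3
      have h4 := Nat.le_of_dvd (by omega) h3
      have : 0 < p * (p - 1) := Nat.mul_pos (by omega) (by omega)
      omega
    refine ⟨(g : F) ^ p - g, sub_ne_zero.mpr hex, ?_⟩
    rw [sub_pow_char, hpp]; ring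
  have hpodd : Odd p := hp.odd_of_ne_two (by omega)
  have hid := corr_identity (fun x : F => x ^ (n0 + p * n1)) (fun x => (x ^ (n0 + p * n1)) ^ p)
    _ hC a 1
  have hsum := (H a 1 ha0 one_ne_zero).sum_comp (fun z => z ^ (p + 1))
  rw [FiniteField.sum_pow_lt_card_sub_one _ _ (by rw [hF, hq]; nlinarith [Nat.sub_add_cancel (show 1 ≤ p by omega)])] at hsum
  have hsub : ∀ x y : F, (x - y) ^ p = x ^ p - y ^ p := fun x y => sub_pow_char x y
  simp only [pow_succ' _ p, hsub] at hsum
  rw [hsum] at hid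
  simp only [hpodd.neg_pow, hsub, hfr, ha, one_pow] at hid
  rw [zero_pow hp.ne_zero] at hid
  have hfin : (12 * κ) * (a ^ 2 * (a ^ 2 - 1)) = 0 := by
    linear_combination hid
  have hsmall : ∀ k : ℕ, 0 < k → k < 5 → (k : F) ≠ 0 := by
    intro k hk hk5 h
    rw [CharP.cast_eq_zero_iff F p] at h
    have := Nat.le_of_dvd hk h; omega
  have h2 : (2 : F) ≠ 0 := by exact_mod_cast hsmall 2 (by norm_num) (by norm_num)
  have h3 : (3 : F) ≠ 0 := by exact_mod_cast hsmall 3 (by norm_num) (by norm_num)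
  have h12 : (12 : F) ≠ 0 := by
    have : (12 : F) = 2 * 2 * 3 := by norm_num
    rw [this]; exact mul_ne_zero (mul_ne_zero h2 h2) h3
  have ha1 : a ^ 2 - 1 ≠ 0 := by
    intro h
    have h4 : (a - 1) * (a + 1) = 0 := by linear_combination h
    have h5 : a ^ p = a := by
      rcases mul_eq_zero.mp h4 with h | h
      · rw [sub_eq_zero.mp h, one_pow]
      · rw [eq_neg_of_add_eq_zero_left h, hpodd.neg_pow, one_pow]
    rw [ha] at h5
    have : 2 * a = 0 := by linear_combination -h5
    exact (mul_ne_zero h2 ha0) this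
  exact (mul_ne_zero (mul_ne_zero h12 hκ) (mul_ne_zero (pow_ne_zero 2 ha0) ha1)) hfin

/-- exclusion of `2+p` and `1+2p` when `p ≡ 2 mod 3` -/
lemma omega_case {p n : ℕ} [Fact p.Prime] (hp5 : 5 ≤ p) {F : Type} [Field F] [Fintype F]
    [CharP F p] (hF : Fintype.card F = p ^ 2) (h3 : p % 3 = 2) (hn : n = 2 + p ∨ n = 1 + 2 * p)
    (H : SecPN F n) : False := by
  have hp := (Fact.out : p.Prime)
  have hfr : ∀ x y : F, (x + y) ^ p = x ^ p + y ^ p := fun x y => add_pow_char x y p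
  obtain ⟨k, hk⟩ : ∃ k, p + 1 = 3 * k := ⟨(p + 1) / 3, by omega⟩
  have hq : p ^ 2 - 1 = 3 * (k * (p - 1)) := by
    rw [← mul_assoc, ← hk]
    have := Nat.sq_sub_sq p 1
    simpa using this
  obtain ⟨c, hc0, w, hw1, hw3, hcw⟩ :
      ∃ c : F, c ≠ 0 ∧ ∃ w : F, w ≠ 1 ∧ w ^ 3 = 1 ∧ c ^ p = w * c := by
    obtain ⟨g, hg⟩ := IsCyclic.exists_ofOrder_eq_natCard (α := Fˣ)
    have hcard : Nat.card Fˣ = p ^ 2 - 1 := by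
      rw [Nat.card_units, Nat.card_eq_fintype_card, hF]
    have hpos : 0 < k * (p - 1) := Nat.mul_pos (by omega) (by omega)
    refine ⟨((g ^ k : Fˣ) : F), Units.ne_zero _, ((g ^ (k * (p - 1)) : Fˣ) : F), ?_, ?_, ?_⟩
    · intro h
      have h2 : g ^ (k * (p - 1)) = 1 := by ext; simpa using h
      have h4 := Nat.le_of_dvd hpos (orderOf_dvd_of_pow_eq_one h2)
      rw [hg, hcard, hq] at h4
      omega
    · rw [← Units.val_pow_eq_pow_val, ← pow_mul, mul_comm _ 3, ← hq, ← hcard, ← hg,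
        pow_orderOf_eq_one, Units.val_one]
    · rw [← Units.val_pow_eq_pow_val, ← Units.val_mul, ← pow_mul, ← pow_add]
      congr 2
      obtain ⟨r, rfl⟩ : ∃ r, p = r + 1 := ⟨p - 1, by omega⟩
      simp only [Nat.add_sub_cancel]; ring
  have hw : 1 + w + w ^ 2 = 0 := by
    have : (w - 1) * (1 + w + w ^ 2) = 0 := by linear_combination hw3
    exact (mul_eq_zero.mp this).resolve_left (sub_ne_zero.mpr hw1)
  have hinj := (H c (c ^ 2) hc0 (pow_ne_zero 2 hc0)).injective
  have h01 : (1 : F) = 0 := by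
    apply hinj
    have hc2 : (c ^ 2) ^ p = w ^ 2 * c ^ 2 := by rw [pow_right_comm, hcw]; ring
    rcases hn with rfl | rfl
    · simp only [pow_add _ 2 p, hfr, hcw, hc2, one_pow]
      rw [zero_pow hp.ne_zero]
      linear_combination (2 * c ^ 3) * hw
    · have e : ∀ x : F, x ^ (1 + 2 * p) = x * (x ^ p) ^ 2 := by
        intro x; rw [pow_add, pow_one, mul_comm 2 p, pow_mul]
      simp only [e, hfr, hcw, hc2, one_pow]
      rw [zero_pow hp.ne_zero]
      linear_combination (2 * c ^ 3) * hw + (2 * c ^ 3) * hw3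
  exact one_ne_zero h01

theorem twoPN_p_squared (p n : ℕ) (hp : p.Prime) (hp5 : 5 ≤ p)
    (hn0 : 0 < n) (hn : n ≤ p^2 - 1)
    (F : Type) [Field F] [Fintype F] (hF : Fintype.card F = p^2)
    (h : IsKPN 2 (fun x : F => x^n)) :
    (p % 3 = 2 → n ∈ ({3, 3*p} : Set ℕ)) ∧
    (p % 3 = 1 → n ∈ ({3, 3*p, 1 + 2*p, 2 + p} : Set ℕ)) := by
  have : Fact p.Prime := ⟨hp⟩
  have : CharP F p := by
    apply charP_of_card_eq_prime_pow (f := 2)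
    rw [hF]
  have H := secPN_of_isKPN h
  obtain ⟨l, hl⟩ := mod_case hp5 hn0 (restrict_prime (p := p) H)
  have hdm : n % p + p * (n / p) = n := Nat.mod_add_div n p
  have hlt : n % p < p := Nat.mod_lt _ (by omega)
  have hlt1 : n / p < p := by
    rw [Nat.div_lt_iff_lt_mul (by omega), ← pow_two]
    have : 0 < p ^ 2 := by positivity
    omega
  generalize n % p = n0 at *
  generalize n / p = n1 at *
  have hs : n0 + n1 = 3 ∨ n0 + n1 = p + 2 := by
    obtain ⟨r, rfl⟩ : ∃ r, p = r + 1 := ⟨p - 1, by omega⟩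
    simp only [Nat.add_sub_cancel] at hl
    have e : ((n0 + n1 : ℕ) : ℤ) - 3 = r * ((l : ℤ) - n1) := by
      have : ((n0 + (r + 1) * n1 : ℕ) : ℤ) = ((3 + r * l : ℕ) : ℤ) := by rw [hdm, hl]
      push_cast at this ⊢
      linear_combination this
    generalize (l : ℤ) - n1 = z at e
    have hz1 : z < 2 := by
      by_contra hh
      have : (r : ℤ) * 2 ≤ r * z := mul_le_mul_of_nonneg_left (by omega) (by positivity)
      omega
    have hz2 : -1 < z := by
      by_contra hh
      have : (r : ℤ) * z ≤ r * (-1) := mul_le_mul_of_nonneg_left (by omega) (by positivity)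
      omega
    have : z = 0 ∨ z = 1 := by omega
    rcases this with rfl | rfl <;> omega
  rcases hs with hs | hs
  · have hcases : n = 3 ∨ n = 2 + p ∨ n = 1 + 2 * p ∨ n = 3 * p := by
      have : n1 ≤ 3 := by omega
      interval_cases n1 <;> omega
    refine ⟨fun h3 => ?_, fun _ => ?_⟩
    · rcases hcases with h | h | h | h
      · simp [h]
      · exact (omega_case hp5 hF h3 (Or.inl h) H).elim
      · exact (omega_case hp5 hF h3 (Or.inr h) H).elim
      · simp [h]
    · simp only [Set.mem_insert_iff, Set.mem_singleton_iff]
      tauto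
  · rw [← hdm] at H
    exact (big_case hp5 hF hlt hlt1 hs H).elim
end
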